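/- arXiv:2105.02360 — 2 statements merged into one kernel-verified Lean document; each statement's English description precedes it below -/
import Mathlib

section
/- Let λ > 0, let y₁,…,yₙ ∈ ℝ³ be distinct points, and let D = {x_k : k ∈ ℕ} ⊆ ℝ³ \ {y₁,…,yₙ} be a countable set of distinct points whose closure contains a nonempty open set. Then there exists N₁ ≥ 1 such that for every N ≥ N₁ the linear map Φ_λ^N : ℝⁿ → ℝ^N is injective, i.e. its n columns φ_λ^N(y₁),…,φ_λ^N(yₙ) are linearly independent in ℝ^N. -/
open Real Matrix

open Filter Topology in
/-- A linear combination of Yukawa potentials centred at distinct points that vanishes away from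
the centres is trivial. -/
theorem yukawa_coeff_eq_zero {E ι : Type*} [NormedAddCommGroup E] [NormedSpace ℝ E] [Nontrivial E]
    [Fintype ι] (s : ℝ) {y : ι → E} (hy : Function.Injective y) (c : ι → ℝ)
    (h : ∀ z ∉ Set.range y, ∑ j, Real.exp (-(s * ‖z - y j‖)) / ‖z - y j‖ * c j = 0) :
    c = 0 := by
  classical
  funext i
  have : (𝓝[≠] y i).NeBot := Module.punctured_nhds_neBot ℝ E (y i)
  have hterm : ∀ j ∈ Finset.univ, Tendsto
      (fun z => ‖z - y i‖ * (Real.exp (-(s * ‖z - y j‖)) / ‖z - y j‖ * c j)) (𝓝[≠] y i)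
      (𝓝 (if j = i then c j else 0)) := by
    intro j _
    split_ifs with hji
    · subst hji
      have hlim : Tendsto (fun z => Real.exp (-(s * ‖z - y j‖)) * c j) (𝓝[≠] y j)
          (𝓝 (Real.exp (-(s * ‖y j - y j‖)) * c j)) :=
        (Continuous.tendsto (by fun_prop) _).mono_left nhdsWithin_le_nhds
      simp only [sub_self, norm_zero, mul_zero, neg_zero, Real.exp_zero, one_mul] at hlim
      refine hlim.congr' ?_
      filter_upwards [self_mem_nhdsWithin] with z hz
      have hz' : ‖z - y j‖ ≠ 0 := norm_ne_zero_iff.2 (sub_ne_zero.2 hz)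
      field_simp
    · have hne : ‖y i - y j‖ ≠ 0 :=
        norm_ne_zero_iff.2 (sub_ne_zero.2 fun e => hji (hy e).symm)
      have hcont : ContinuousAt
          (fun z => ‖z - y i‖ * (Real.exp (-(s * ‖z - y j‖)) / ‖z - y j‖ * c j)) (y i) := by
        fun_prop (disch := exact hne)
      simpa [ContinuousAt] using hcont.tendsto.mono_left (nhdsWithin_le_nhds (s := {y i}ᶜ))
  have hsum := tendsto_finsetSum _ hterm
  rw [Finset.sum_ite_eq' Finset.univ i c, if_pos (Finset.mem_univ i)] at hsum
  refine tendsto_nhds_unique hsum (tendsto_const_nhds.congr' ?_)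
  have hother : ∀ᶠ z in 𝓝[≠] y i, z ∉ Set.range y \ {y i} :=
    nhdsWithin_le_nhds (((Set.finite_range y).subset Set.sdiff_subset).isClosed.isOpen_compl.mem_nhds
      (by simp))
  filter_upwards [hother, self_mem_nhdsWithin] with z hz hzi
  rw [← Finset.mul_sum, h z fun hr => hz ⟨hr, hzi⟩, mul_zero, Pi.zero_apply]

/-- Off its centres, a linear combination of Yukawa potentials is real analytic. -/
theorem analyticOnNhd_yukawa {E ι : Type*} [NormedAddCommGroup E] [InnerProductSpace ℝ E]
    [CompleteSpace E] [Fintype ι] (s : ℝ) (y : ι → E) (c : ι → ℝ) :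
    AnalyticOnNhd ℝ (fun z => ∑ j, Real.exp (-(s * ‖z - y j‖)) / ‖z - y j‖ * c j)
      (Set.range y)ᶜ := by
  intro z hz
  refine Finset.analyticAt_fun_sum _ fun j _ => ?_
  have hne : z - y j ≠ 0 := sub_ne_zero.2 fun e => hz ⟨j, e.symm⟩
  have hnorm : AnalyticAt ℝ (fun z => ‖z - y j‖) z :=
    ((contDiffAt_id.sub contDiffAt_const).norm ℝ hne).analyticAt
  exact (((analyticAt_const.mul hnorm).neg.rexp).div hnorm (norm_ne_zero_iff.2 hne)).mul
    analyticAt_const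

/-- A linear combination of Yukawa potentials that vanishes on a set whose closure has nonempty
interior is trivial. -/
theorem yukawa_coeff_eq_zero_of_dense {E ι : Type*} [NormedAddCommGroup E]
    [InnerProductSpace ℝ E] [CompleteSpace E] [Fintype ι] (hE : 1 < Module.rank ℝ E) (s : ℝ)
    {y : ι → E} (hy : Function.Injective y) (c : ι → ℝ) {D U : Set E} (hU : U.Nonempty)
    (hUo : IsOpen U) (hUD : U ⊆ closure D)
    (h : ∀ z ∈ D, ∑ j, Real.exp (-(s * ‖z - y j‖)) / ‖z - y j‖ * c j = 0) :
    c = 0 := by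
  have : Nontrivial E := rank_pos_iff_nontrivial.1 (zero_lt_one.trans hE)
  have hYfin := Set.finite_range y
  have hYo : IsOpen (Set.range y)ᶜ := hYfin.isClosed.isOpen_compl
  have han := analyticOnNhd_yukawa s y c
  have hzero : ∀ z ∈ U, z ∉ Set.range y →
      ∑ j, Real.exp (-(s * ‖z - y j‖)) / ‖z - y j‖ * c j = 0 := by
    intro z hzU hzY
    have := mem_closure_iff_nhdsWithin_neBot.1 (hUD hzU)
    refine tendsto_nhds_unique
      ((han z hzY).continuousAt.tendsto.mono_left (nhdsWithin_le_nhds (s := D))) ?_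
    refine tendsto_const_nhds.congr' ?_
    filter_upwards [self_mem_nhdsWithin] with w hw using (h w hw).symm
  obtain ⟨z₀, hz₀U, hz₀Y⟩ : (U ∩ (Set.range y)ᶜ).Nonempty :=
    (hYfin.countable.dense_compl ℝ).inter_open_nonempty U hUo hU
  have hconn := (hYfin.countable.isPathConnected_compl_of_one_lt_rank hE).isConnected.isPreconnected
  refine yukawa_coeff_eq_zero s hy c fun z hz =>
    han.eqOn_zero_of_preconnected_of_eventuallyEq_zero hconn hz₀Y ?_ hz
  filter_upwards [hUo.mem_nhds hz₀U, hYo.mem_nhds hz₀Y] with z hzU hzY using hzero z hzU hzY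

/-- If infinitely many linear equations in finitely many unknowns have only the trivial solution,
then so do finitely many of them. -/
theorem exists_forall_injective_mulVec {K ι : Type*} [Field K] [Fintype ι] (a : ℕ → ι → K)
    (h : ∀ c : ι → K, (∀ k, ∑ j, a k j * c j = 0) → c = 0) :
    ∃ N₀ : ℕ, ∀ N, N₀ ≤ N →
      Function.Injective (Matrix.of fun (k : Fin N) (j : ι) => a k j).mulVec := by
  let V : ℕ → Submodule K (ι → K) :=
    fun N => LinearMap.ker (Matrix.of fun (k : Fin N) (j : ι) => a k j).mulVecLin
  have hV : ∀ N c, c ∈ V N ↔ ∀ k < N, ∑ j, a k j * c j = 0 := by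
    intro N c
    simp only [V, LinearMap.mem_ker, Matrix.mulVecLin_apply, funext_iff, Fin.forall_iff]
    rfl
  have hanti : Antitone V := fun M N hMN c hc =>
    (hV M c).2 fun k hk => (hV N c).1 hc k (hk.trans_le hMN)
  obtain ⟨N₀, hN₀⟩ := IsArtinian.monotone_stabilizes (⟨V, hanti⟩ : ℕ →o (Submodule K (ι → K))ᵒᵈ)
  replace hN₀ : ∀ m, N₀ ≤ m → V N₀ = V m := hN₀
  refine ⟨N₀, fun N hN => LinearMap.ker_eq_bot.1 (?_ : V N = ⊥)⟩
  refine (Submodule.eq_bot_iff _).2 fun c hc => h c fun k => ?_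
  have hmem : c ∈ V (max N₀ (k + 1)) := by
    rwa [← hN₀ _ (le_max_left _ _), hN₀ N hN]
  exact (hV _ c).1 hmem k (Nat.lt_of_succ_le (le_max_right _ _))

/-- For `N` large enough, the linear map `Φ_λ^N : ℝⁿ → ℝ^N` is injective, i.e. its columns
`φ_λ^N(y₁),…,φ_λ^N(yₙ)` are linearly independent. -/
theorem stmt_9 {n : ℕ} (lam : ℝ) (hlam : 0 < lam)
    (y : Fin n → EuclideanSpace ℝ (Fin 3)) (hy : Function.Injective y)
    (x : ℕ → EuclideanSpace ℝ (Fin 3)) (hx : Function.Injective x)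
    (hxY : Set.range x ⊆ (Set.range y)ᶜ)
    (hDopen : ∃ U : Set (EuclideanSpace ℝ (Fin 3)),
      U.Nonempty ∧ IsOpen U ∧ U ⊆ closure (Set.range x)) :
    ∃ N₁ : ℕ, 1 ≤ N₁ ∧ ∀ N, N₁ ≤ N →
      Function.Injective (Matrix.of fun (k : Fin N) (j : Fin n) =>
          Real.exp (-(Real.sqrt lam * ‖x k - y j‖)) / ‖x k - y j‖).mulVec := by
  obtain ⟨U, hU, hUo, hUD⟩ := hDopen
  have hrank : 1 < Module.rank ℝ (EuclideanSpace ℝ (Fin 3)) := by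
    rw [← Module.finrank_eq_rank, finrank_euclideanSpace_fin]
    norm_num
  obtain ⟨N₀, hN₀⟩ := exists_forall_injective_mulVec
    (fun k j => Real.exp (-(Real.sqrt lam * ‖x k - y j‖)) / ‖x k - y j‖) fun c hc =>
      yukawa_coeff_eq_zero_of_dense hrank (Real.sqrt lam) hy c hU hUo hUD
        (Set.forall_mem_range.2 hc)
  exact ⟨N₀ + 1, Nat.le_add_left 1 N₀, fun N hN => hN₀ N ((Nat.le_succ N₀).trans hN)⟩
end

section
/- Let λ > 0, let K ⊂ ℝ³ be compact, let Y = {y₁,…,yₙ} ⊂ K consist of n distinct points, let α ∈ ℝⁿ be such that the matrix M_λ is positive-definite, and let D = {x_k : k ∈ ℕ} ⊆ K \ Y be a countable set of distinct points whose closure contains a nonempty open set. For N ≥ 1 define F_λ^N := (4π)^{−2} · Φ_λ^N · M_λ^{−1} · (Φ_λ^N)ᵀ, a linear map on ℝ^N. Then there exists N∘ ≥ 1 such that for every N ≥ N∘ and every z ∈ K \ D: z ∈ Y if and only if φ_λ^N(z) lies in the orthogonal complement of the kernel of F_λ^N. -/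
open Real Matrix

open Filter Topology

theorem sum_image_extend_mul {ι X : Type*} [Fintype ι] [DecidableEq X] {y : ι → X}
    (hy : Function.Injective y) (b : ι → ℝ) (e F : X → ℝ) :
    ∑ q ∈ Finset.univ.image y, Function.extend y b e q * F q = ∑ j, b j * F (y j) := by
  rw [Finset.sum_image hy.injOn]
  simp [hy.extend_apply]

/-- If functions `h m` converging pointwise to `h₀` eventually agree at each point with linear
combinations of fixed functions `g j`, then `h₀` and the `g j` are linearly dependent. -/
theorem exists_linear_relation_of_tendsto {X ι : Type*} [Fintype ι] {D : Set X} {g : ι → X → ℝ}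
    {h : ℕ → X → ℝ} {h₀ : X → ℝ} {c : ℕ → ι → ℝ}
    (hlim : ∀ x ∈ D, Tendsto (fun m => h m x) atTop (𝓝 (h₀ x)))
    (heq : ∀ x ∈ D, ∀ᶠ m in atTop, h m x = ∑ j, c m j * g j x) :
    ∃ (t : ℝ) (a : ι → ℝ), (t, a) ≠ 0 ∧ ∀ x ∈ D, t * h₀ x = ∑ j, a j * g j x := by
  set u : ℕ → ℝ × (ι → ℝ) := fun m => (1, c m) with hu
  have hu0 (m) : u m ≠ 0 := by simp [hu, Prod.ext_iff]
  obtain ⟨b, hb, φ, hφ, hlimb⟩ := (isCompact_sphere (0 : ℝ × (ι → ℝ)) 1).tendsto_subseq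
    (x := fun m => ‖u m‖⁻¹ • u m) (fun m => by simp [norm_smul, hu0 m])
  refine ⟨b.1, b.2, ?_, fun x hx => ?_⟩
  · rintro h0
    rw [show b = 0 from h0] at hb
    simp at hb
  · have h1 := ((continuous_fst.tendsto b).comp hlimb).mul ((hlim x hx).comp hφ.tendsto_atTop)
    have h2 : Tendsto (fun m => ∑ j, (‖u (φ m)‖⁻¹ • u (φ m)).2 j * g j x) atTop
        (𝓝 (∑ j, b.2 j * g j x)) :=
      tendsto_finsetSum _ fun j _ =>
        (((by fun_prop : Continuous fun w : ℝ × (ι → ℝ) => w.2 j).tendsto b).comp hlimb).mul_const _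
    refine tendsto_nhds_unique h1 (h2.congr' ?_)
    filter_upwards [hφ.tendsto_atTop.eventually (heq x hx)] with m hm
    simp [hu, hm, Finset.mul_sum, mul_assoc]

section YukawaPotential

variable {E : Type*} [NormedAddCommGroup E]

/-- The Yukawa potential with screening parameter `s` and pole `p`. -/
noncomputable def yukawa (s : ℝ) (p x : E) : ℝ := Real.exp (-(s * ‖x - p‖)) / ‖x - p‖

theorem yukawa_comm (s : ℝ) (p x : E) : yukawa s p x = yukawa s x p := by
  simp only [yukawa, norm_sub_rev]

variable [InnerProductSpace ℝ E]

/-- The derivative of the Yukawa potential with respect to its pole `p`, in the direction `v`. -/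
noncomputable def yukawaDipole (s : ℝ) (p v x : E) : ℝ :=
  Real.exp (-(s * ‖x - p‖)) * (s * ‖x - p‖ + 1) / ‖x - p‖ ^ 3 * inner ℝ v (x - p)

theorem yukawa_analyticAt (s : ℝ) {p x : E} (h : x ≠ p) : AnalyticAt ℝ (yukawa s p) x := by
  have h0 : x - p ≠ 0 := sub_ne_zero.2 h
  have hn : ContDiffAt ℝ ⊤ (fun q : E => ‖q - p‖) x :=
    (contDiffAt_id.sub contDiffAt_const).norm ℝ h0
  exact (((contDiffAt_const.mul hn).neg.exp).div hn (norm_ne_zero_iff.2 h0)).analyticAt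

theorem yukawaDipole_analyticAt (s : ℝ) {p x : E} (v : E) (h : x ≠ p) :
    AnalyticAt ℝ (yukawaDipole s p v) x := by
  have h0 : x - p ≠ 0 := sub_ne_zero.2 h
  have hn : ContDiffAt ℝ ⊤ (fun q : E => ‖q - p‖) x :=
    (contDiffAt_id.sub contDiffAt_const).norm ℝ h0
  exact ((((contDiffAt_const.mul hn).neg.exp).mul ((contDiffAt_const.mul hn).add
    contDiffAt_const)).div (hn.pow 3) (pow_ne_zero 3 (norm_ne_zero_iff.2 h0)) |>.mul
    (contDiffAt_const.inner ℝ (contDiffAt_id.sub contDiffAt_const))).analyticAt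

theorem hasFDerivAt_yukawa_pole (s : ℝ) {p x : E} (h : x ≠ p) :
    ∃ L : E →L[ℝ] ℝ, HasFDerivAt (fun q => yukawa s q x) L p ∧
      ∀ v, L v = yukawaDipole s p v x := by
  have h0 : x - p ≠ 0 := sub_ne_zero.2 h
  have hr : ‖x - p‖ ≠ 0 := norm_ne_zero_iff.2 h0
  have h1 := (((hasFDerivAt_const x p).sub (hasFDerivAt_id p)).norm_sq).sqrt (by simpa using h0)
  simp only [Pi.sub_apply, id, Real.sqrt_sq (norm_nonneg _)] at h1
  have h2 : HasDerivAt (fun r : ℝ => Real.exp (-(s * r)) / r) _ ‖x - p‖ :=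
    (((hasDerivAt_id ‖x - p‖).const_mul s).neg.exp).div (hasDerivAt_id ‖x - p‖) hr
  refine ⟨_, HasDerivAt.comp_hasFDerivAt (h₂ := fun r : ℝ => Real.exp (-(s * r)) / r) p h2 h1,
    fun v => ?_⟩
  simp [yukawaDipole, inner_sub_right, real_inner_comm v]
  field_simp
  ring

theorem tendsto_yukawa_slope (s : ℝ) {p x v : E} (h : x ≠ p) {z : ℕ → E}
    (hz : Tendsto z atTop (𝓝 p))
    (hv : Tendsto (fun m => ‖z m - p‖⁻¹ • (z m - p)) atTop (𝓝 v)) :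
    Tendsto (fun m => ‖z m - p‖⁻¹ * (yukawa s (z m) x - yukawa s p x)) atTop
      (𝓝 (yukawaDipole s p v x)) := by
  obtain ⟨L, hL, hLv⟩ := hasFDerivAt_yukawa_pole s h
  have := (hasFDerivWithinAt_univ.2 hL).lim (by simpa using hz.sub_const p)
    (.of_forall fun _ => Set.mem_univ _) hv
  simpa [hLv] using this

theorem tendsto_mul_yukawa_along (s : ℝ) (p q : E) {v : E} (hv : ‖v‖ = 1) [Decidable (q = p)] :
    Tendsto (fun ε : ℝ => ε * yukawa s q (p + ε • v)) (𝓝[>] 0) (𝓝 (if q = p then 1 else 0)) := by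
  split_ifs with h
  · subst h
    have h1 : Tendsto (fun ε : ℝ => Real.exp (-(s * ε))) (𝓝[>] 0) (𝓝 1) :=
      ((by fun_prop : Continuous fun ε : ℝ => Real.exp (-(s * ε))).tendsto' 0 1
        (by simp)).mono_left nhdsWithin_le_nhds
    refine h1.congr' ?_
    filter_upwards [self_mem_nhdsWithin] with ε (hε : 0 < ε)
    simp only [yukawa, add_sub_cancel_left, norm_smul, hv, Real.norm_of_nonneg hε.le, mul_one]
    field_simp
  · have h1 : ContinuousAt (fun ε : ℝ => ε * yukawa s q (p + ε • v)) 0 := by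
      refine continuousAt_id.mul (ContinuousAt.comp (g := yukawa s q) ?_ (by fun_prop))
      simpa using (yukawa_analyticAt s (Ne.symm h)).continuousAt
    simpa [ContinuousAt] using h1.tendsto.mono_left nhdsWithin_le_nhds

theorem tendsto_sq_mul_yukawaDipole_along (s : ℝ) (p : E) {v : E} (hv : ‖v‖ = 1) :
    Tendsto (fun ε : ℝ => ε ^ 2 * yukawaDipole s p v (p + ε • v)) (𝓝[>] 0) (𝓝 1) := by
  have h1 : Tendsto (fun ε : ℝ => Real.exp (-(s * ε)) * (s * ε + 1)) (𝓝[>] 0) (𝓝 1) :=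
    ((by fun_prop : Continuous fun ε : ℝ => Real.exp (-(s * ε)) * (s * ε + 1)).tendsto' 0 1
      (by simp)).mono_left nhdsWithin_le_nhds
  refine h1.congr' ?_
  filter_upwards [self_mem_nhdsWithin] with ε (hε : 0 < ε)
  simp only [yukawaDipole, add_sub_cancel_left, norm_smul, hv, Real.norm_of_nonneg hε.le, mul_one,
    inner_smul_right, real_inner_self_eq_norm_sq]
  field_simp

theorem eventually_along_notMem (T : Finset E) (p : E) {v : E} (hv : ‖v‖ = 1) :
    ∀ᶠ ε : ℝ in 𝓝[>] 0, p + ε • v ∉ T := by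
  have hc : Tendsto (fun ε : ℝ => p + ε • v) (𝓝[>] 0) (𝓝[≠] p) := by
    refine tendsto_nhdsWithin_iff.2 ⟨?_, ?_⟩
    · exact ((by fun_prop : Continuous fun ε : ℝ => p + ε • v).tendsto' 0 p
        (by simp)).mono_left nhdsWithin_le_nhds
    · filter_upwards [self_mem_nhdsWithin] with ε (hε : 0 < ε)
      have : v ≠ 0 := by rintro rfl; simp at hv
      simp [hε.ne', this]
  have : ∀ᶠ q in 𝓝[≠] p, q ∉ T := by
    classical
    have h := (T.erase p).finite_toSet.isClosed.isOpen_compl.mem_nhds (x := p) (by simp)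
    filter_upwards [mem_nhdsWithin_of_mem_nhds h, self_mem_nhdsWithin] with q h1 h2 h3
    exact h1 (Finset.mem_coe.2 (Finset.mem_erase.2 ⟨h2, h3⟩))
  exact hc.eventually this

/-- Yukawa potentials with distinct poles, together with one dipole, are linearly independent,
even when restricted to a set which is dense in a nonempty open set. -/
theorem yukawa_coeff_eq_zero_s11 [Nontrivial E] (hE : 1 < Module.rank ℝ E) (s : ℝ) {D U : Set E}
    (hU : U.Nonempty) (hUo : IsOpen U) (hUD : U ⊆ closure D) (S : Finset E) (a : E → ℝ) (t : ℝ)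
    (p v : E) (hv : ‖v‖ = 1)
    (h : ∀ x ∈ D, x ∉ S → x ≠ p → ∑ q ∈ S, a q * yukawa s q x + t * yukawaDipole s p v x = 0) :
    t = 0 ∧ ∀ q ∈ S, a q = 0 := by
  classical
  set f : E → ℝ := fun x => ∑ q ∈ S, a q * yukawa s q x + t * yukawaDipole s p v x with hf
  set T : Finset E := insert p S with hT
  have hfa : AnalyticOnNhd ℝ f (T : Set E)ᶜ := by
    intro x hx
    have hx' : x ≠ p ∧ x ∉ S := by simpa [hT] using hx
    refine AnalyticAt.add (Finset.analyticAt_fun_sum _ fun q hq => ?_) ?_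
    · exact analyticAt_const.mul (yukawa_analyticAt s fun h => hx'.2 (h ▸ hq))
    · exact analyticAt_const.mul (yukawaDipole_analyticAt s v hx'.1)
  have hTo : IsOpen (T : Set E)ᶜ := T.finite_toSet.isClosed.isOpen_compl
  have hdense : Dense (T : Set E)ᶜ :=
    T.countable_toSet.dense_compl ℝ
  obtain ⟨x₀, hx₀U, hx₀T⟩ := hdense.inter_open_nonempty U hUo hU
  have hzero : ∀ x ∈ U ∩ (T : Set E)ᶜ, f x = 0 := by
    intro x hx
    have hmem : x ∈ closure (D ∩ (T : Set E)ᶜ) := by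
      rw [Set.inter_comm]
      exact hTo.inter_closure ⟨hx.2, hUD hx.1⟩
    have : f x ∈ closure ({0} : Set ℝ) := by
      refine ((hfa x hx.2).continuousAt.continuousWithinAt).mem_closure hmem ?_
      rintro q ⟨hqD, hqT⟩
      have hq : q ≠ p ∧ q ∉ S := by simpa [hT] using hqT
      exact h q hqD hq.2 hq.1
    simpa using this
  have hall : Set.EqOn f 0 (T : Set E)ᶜ := by
    refine hfa.eqOn_zero_of_preconnected_of_eventuallyEq_zero
      (T.countable_toSet.isConnected_compl_of_one_lt_rank hE).isPreconnected hx₀T ?_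
    filter_upwards [(hUo.inter hTo).mem_nhds ⟨hx₀U, hx₀T⟩] with x hx using hzero x hx
  have hev (q : E) : ∀ᶠ ε : ℝ in 𝓝[>] 0, f (q + ε • v) = 0 := by
    filter_upwards [eventually_along_notMem T q hv] with ε hε using hall hε
  have hid : Tendsto (fun ε : ℝ => ε) (𝓝[>] 0) (𝓝 0) := nhdsWithin_le_nhds
  have ht : t = 0 := by
    have h1 : Tendsto (fun ε : ℝ => ε ^ 2 * f (p + ε • v)) (𝓝[>] 0) (𝓝 t) := by
      have := (tendsto_finsetSum S fun q _ =>
        ((hid.mul (tendsto_mul_yukawa_along s p q hv)).const_mul (a q))).add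
        ((tendsto_sq_mul_yukawaDipole_along s p hv).const_mul t)
      simp only [zero_mul, mul_zero, Finset.sum_const_zero, zero_add, mul_one] at this
      refine this.congr fun ε => ?_
      simp only [hf, mul_add, Finset.mul_sum]
      congr 1
      · exact Finset.sum_congr rfl fun q _ => by ring
      · ring
    refine tendsto_nhds_unique h1 (tendsto_const_nhds.congr' ?_)
    filter_upwards [hev p] with ε hε
    simp [hε]
  refine ⟨ht, fun r hr => ?_⟩
  have h1 : Tendsto (fun ε : ℝ => ε * f (r + ε • v)) (𝓝[>] 0) (𝓝 (a r)) := by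
    have := tendsto_finsetSum S fun q _ => (tendsto_mul_yukawa_along s r q hv).const_mul (a q)
    simp only [mul_ite, mul_one, mul_zero, Finset.sum_ite_eq', hr, if_true] at this
    refine this.congr fun ε => ?_
    simp only [hf, ht, zero_mul, add_zero, Finset.mul_sum]
    exact Finset.sum_congr rfl fun q _ => by ring
  refine tendsto_nhds_unique h1 (tendsto_const_nhds.congr' ?_)
  filter_upwards [hev r] with ε hε
  simp [hε]

/-- Sampled on sufficiently many points of a sequence whose closure contains a nonempty open set,
a Yukawa potential is a linear combination of Yukawa potentials with given poles only if its own
pole is one of them. The number of sampling points is uniform over poles in a compact set. -/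
theorem exists_forall_mem_range_of_yukawa_eq_sum [Nontrivial E] [ProperSpace E]
    (hE : 1 < Module.rank ℝ E) (s : ℝ) {n : ℕ} {K : Set E} (hK : IsCompact K) {y : Fin n → E}
    (hy : Function.Injective y) {x : ℕ → E} (hxy : ∀ k, x k ∉ Set.range y)
    {U : Set E} (hU : U.Nonempty) (hUo : IsOpen U) (hUD : U ⊆ closure (Set.range x)) :
    ∃ N₀ : ℕ, ∀ N, N₀ ≤ N → ∀ z ∈ K, ∀ c : Fin n → ℝ,
      (∀ k < N, yukawa s z (x k) = ∑ j, c j * yukawa s (y j) (x k)) → z ∈ Set.range y := by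
  classical
  by_contra! hcon
  choose N hN z hzK c hc hzy using hcon
  obtain ⟨p, -, φ, hφ, hzp⟩ := hK.tendsto_subseq hzK
  have hev {ψ : ℕ → ℕ} (hψ : Tendsto ψ atTop atTop) (k : ℕ) : ∀ᶠ m in atTop,
      yukawa s (z (ψ m)) (x k) = ∑ j, c (ψ m) j * yukawa s (y j) (x k) := by
    filter_upwards [hψ.eventually_gt_atTop k] with m hm
    exact hc _ k (hm.trans_le (hN _))
  by_cases hp : p ∈ Set.range y
  · obtain ⟨i, rfl⟩ := hp
    have hne (m : ℕ) : z m - y i ≠ 0 := sub_ne_zero.2 fun h => hzy m ⟨i, h.symm⟩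
    obtain ⟨v, hv, ψ, hψ, hlim⟩ := (isCompact_sphere (0 : E) 1).tendsto_subseq
      (x := fun m => ‖z (φ m) - y i‖⁻¹ • (z (φ m) - y i))
      (fun m => by simp [norm_smul, hne])
    obtain ⟨t, a, hta, hrel⟩ := exists_linear_relation_of_tendsto (D := Set.range x)
      (g := fun j => yukawa s (y j)) (h₀ := yukawaDipole s (y i) v)
      (h := fun m q => ‖z (φ (ψ m)) - y i‖⁻¹ * (yukawa s (z (φ (ψ m))) q - yukawa s (y i) q))
      (c := fun m j => ‖z (φ (ψ m)) - y i‖⁻¹ * (c (φ (ψ m)) j - if j = i then 1 else 0))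
      (by
        rintro _ ⟨k, rfl⟩
        exact tendsto_yukawa_slope s (fun h => hxy k ⟨i, h.symm⟩)
          (hzp.comp hψ.tendsto_atTop) hlim)
      (by
        rintro _ ⟨k, rfl⟩
        filter_upwards [hev (hφ.comp hψ).tendsto_atTop k] with m hm
        simp only [Function.comp_apply] at hm
        simp [hm, mul_assoc, sub_mul, ← Finset.mul_sum])
    obtain ⟨ht, ha⟩ := yukawa_coeff_eq_zero_s11 hE s hU hUo hUD (Finset.univ.image y)
      (Function.extend y (-a) 0) t (y i) v (by simpa using hv) (by
        intro q hq _ _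
        rw [sum_image_extend_mul hy _ _ fun r => yukawa s r q, hrel q hq]
        simp)
    refine hta (Prod.ext ht (funext fun j => ?_))
    simpa [hy.extend_apply] using ha (y j) (by simp)
  · obtain ⟨v, hv⟩ := exists_norm_eq E zero_le_one
    obtain ⟨t, a, hta, hrel⟩ := exists_linear_relation_of_tendsto (D := Set.range x \ {p})
      (g := fun j => yukawa s (y j)) (h₀ := yukawa s p)
      (h := fun m => yukawa s (z (φ m))) (c := fun m => c (φ m))
      (by
        rintro q ⟨-, hq⟩
        simp only [yukawa_comm s _ q]
        exact (yukawa_analyticAt s (Ne.symm hq)).continuousAt.tendsto.comp hzp)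
      (by
        rintro _ ⟨⟨k, rfl⟩, -⟩
        exact hev hφ.tendsto_atTop k)
    obtain ⟨-, ha⟩ := yukawa_coeff_eq_zero_s11 hE s hU hUo hUD (insert p (Finset.univ.image y))
      (Function.extend y (-a) fun _ => t) 0 p v hv (by
        intro q hq _ hqp
        rw [Finset.sum_insert (by simpa using hp), Function.extend_apply' _ _ _ hp,
          sum_image_extend_mul hy _ _ fun r => yukawa s r q, hrel q ⟨hq, hqp⟩]
        simp)
    refine hta (Prod.ext ?_ (funext fun j => ?_))
    · simpa [Function.extend_apply' _ _ _ hp] using ha p (by simp)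
    · simpa [hy.extend_apply] using ha (y j) (by simp)

end YukawaPotential

/-- A vector orthogonal to the kernel of `Aᵀ` is in the range of `A`. -/
theorem exists_eq_mulVec_of_forall_transpose_mulVec_eq_zero {m n : Type*} [Fintype m] [Fintype n]
    {A : Matrix m n ℝ} {b : m → ℝ} (h : ∀ w, Aᵀ *ᵥ w = 0 → b ⬝ᵥ w = 0) : ∃ c, b = A *ᵥ c := by
  classical
  obtain ⟨c, hc⟩ := (Submodule.mem_span_range_iff_exists_fun ℝ).1 <| mem_span_of_iInf_ker_le_ker
    (L := fun j => dotProductBilin ℝ ℝ (Aᵀ j)) (K := dotProductBilin ℝ ℝ b) fun w hw => by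
      simp only [Submodule.mem_iInf, LinearMap.mem_ker] at hw ⊢
      exact h w (funext hw)
  refine ⟨c, funext fun i => ?_⟩
  have := LinearMap.congr_fun hc (Pi.single i 1)
  simp at this
  simp [← this, mulVec, dotProduct, mul_comm]

/-- If the quadratic form of `M` is positive, the kernel of `A * M⁻¹ * Aᵀ` is contained in that
of `Aᵀ`. -/
theorem transpose_mulVec_eq_zero_of_mul_inv_mul {m n : Type*} [Fintype m] [Fintype n]
    [DecidableEq n] {M : Matrix n n ℝ} (hM : ∀ ξ : n → ℝ, ξ ≠ 0 → 0 < ξ ⬝ᵥ M *ᵥ ξ)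
    {A : Matrix m n ℝ} {w : m → ℝ} (h : (A * M⁻¹ * Aᵀ) *ᵥ w = 0) : Aᵀ *ᵥ w = 0 := by
  have hdet : IsUnit M.det := by
    refine isUnit_iff_ne_zero.2 fun h0 => ?_
    obtain ⟨v, hv, hv0⟩ := exists_mulVec_eq_zero_iff.2 h0
    simpa [hv0] using hM v hv
  set v := M⁻¹ *ᵥ (Aᵀ *ᵥ w) with hv
  have hMv : M *ᵥ v = Aᵀ *ᵥ w := by
    rw [hv, mulVec_mulVec, mul_nonsing_inv M hdet, one_mulVec]
  rw [← mulVec_mulVec, ← mulVec_mulVec, ← hv] at h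
  have h0 : v ⬝ᵥ M *ᵥ v = 0 := by
    rw [hMv, dotProduct_mulVec, vecMul_transpose, h, zero_dotProduct]
  have hv0 : v = 0 := by
    by_contra hne
    exact (hM v hne).ne' h0
  rw [← hMv, hv0, mulVec_zero]

/-- For `N` large enough, a point `z ∈ K \ D` belongs to `Y = {y₁,…,yₙ}` if and only if the
vector `φ_λ^N(z)` belongs to the orthogonal complement of the kernel of the data operator
`F_λ^N = (4π)⁻² Φ_λ^N M_λ⁻¹ (Φ_λ^N)ᵀ`. -/
theorem stmt_11 {n : ℕ} (lam : ℝ) (hlam : 0 < lam)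
    (K : Set (EuclideanSpace ℝ (Fin 3))) (hK : IsCompact K)
    (y : Fin n → EuclideanSpace ℝ (Fin 3)) (hy : Function.Injective y)
    (hyK : Set.range y ⊆ K)
    (α : Fin n → ℝ)
    (M : Matrix (Fin n) (Fin n) ℝ)
    (hM : ∀ i j : Fin n, M i j =
      if i = j then α i + Real.sqrt lam / (4 * Real.pi)
      else -(Real.exp (-(Real.sqrt lam * ‖y i - y j‖)) / (4 * Real.pi * ‖y i - y j‖)))
    (hMpos : ∀ ξ : Fin n → ℝ, ξ ≠ 0 → 0 < ξ ⬝ᵥ M.mulVec ξ)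
    (x : ℕ → EuclideanSpace ℝ (Fin 3)) (hx : Function.Injective x)
    (hxK : Set.range x ⊆ K \ Set.range y)
    (hDopen : ∃ U : Set (EuclideanSpace ℝ (Fin 3)),
      U.Nonempty ∧ IsOpen U ∧ U ⊆ closure (Set.range x)) :
    ∃ N₀ : ℕ, 1 ≤ N₀ ∧ ∀ N, N₀ ≤ N → ∀ z ∈ K \ Set.range x,
      (z ∈ Set.range y ↔
        ∀ w : Fin N → ℝ,
          (((4 * Real.pi) ^ 2)⁻¹ •
            ((Matrix.of fun (k : Fin N) (j : Fin n) =>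
                Real.exp (-(Real.sqrt lam * ‖x k - y j‖)) / ‖x k - y j‖) * M⁻¹ *
              (Matrix.of fun (k : Fin N) (j : Fin n) =>
                Real.exp (-(Real.sqrt lam * ‖x k - y j‖)) / ‖x k - y j‖)ᵀ)).mulVec w = 0 →
          (fun k : Fin N => Real.exp (-(Real.sqrt lam * ‖x k - z‖)) / ‖x k - z‖) ⬝ᵥ w = 0) := by
  set s := Real.sqrt lam
  obtain ⟨U, hU, hUo, hUD⟩ := hDopen
  have hE : 1 < Module.rank ℝ (EuclideanSpace ℝ (Fin 3)) := by
    rw [← Module.finrank_eq_rank, finrank_euclideanSpace_fin]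
    norm_num
  obtain ⟨N₀, hN₀⟩ := exists_forall_mem_range_of_yukawa_eq_sum hE s hK hy
    (fun k => (hxK ⟨k, rfl⟩).2) hU hUo hUD
  refine ⟨max N₀ 1, le_max_right _ _, fun N hN z hz => ?_⟩
  set A : Matrix (Fin N) (Fin n) ℝ := Matrix.of fun k j =>
    Real.exp (-(s * ‖x k - y j‖)) / ‖x k - y j‖ with hA
  have hc : ((4 * Real.pi) ^ 2)⁻¹ ≠ 0 := by positivity
  constructor
  · rintro ⟨j, rfl⟩ w hw
    rw [smul_mulVec, smul_eq_zero_iff_right hc] at hw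
    exact congr_fun (transpose_mulVec_eq_zero_of_mul_inv_mul hMpos hw) j
  · intro h
    obtain ⟨c, hcA⟩ := exists_eq_mulVec_of_forall_transpose_mulVec_eq_zero (A := A) fun w hw =>
      h w (by rw [smul_mulVec, ← mulVec_mulVec, hw, mulVec_zero, smul_zero])
    refine hN₀ N (le_of_max_le_left hN) z hz.1 c fun k hk => ?_
    refine (congr_fun hcA ⟨k, hk⟩).trans ?_
    simp [hA, mulVec, dotProduct, yukawa, mul_comm]
end
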